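/- Let n ≥ 2 and let A(2n) = ⟨x, y ‖ (xy)ⁿ = (yx)ⁿ⟩ be the 2-generated Artin group, and let p be a prime number. Then A(2n) admits a faithful linear representation by 2n × 2n matrices over the ring ℤ[1/p] of rational numbers whose denominators are powers of p; that is, there is an injective group homomorphism A(2n) → GL_{2n}(ℤ[1/p]). -/

import Mathlib

open scoped MatrixGroups

/-- The defining relation of the 2-generated Artin group `A(2n) = ⟨x, y ‖ (xy)ⁿ = (yx)ⁿ⟩`. -/
def artinEvenRels (n : ℕ) : Set (FreeGroup (Fin 2)) :=
  {(FreeGroup.of 0 * FreeGroup.of 1) ^ n * ((FreeGroup.of 1 * FreeGroup.of 0) ^ n)⁻¹}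

/-- The 2-generated Artin group `A(2n)`. -/
abbrev ArtinEven (n : ℕ) := PresentedGroup (artinEvenRels n)

/-- `ℤ[1/p]`: the subring of `ℚ` generated by `1/p`, i.e. the rational numbers whose
denominators are powers of `p`. -/
def ZinvP (p : ℕ) : Subring ℚ := Subring.closure {((p : ℚ))⁻¹}

/-! ### Free subgroups of `SL(2, R)` generated by parabolic elements -/

section Parabolic

universe u

variable {R : Type u} [CommRing R]

/-- The parabolic element of `SL(2, R)` fixing the vector `(r, 1)` and, for `b c : R`, sending
`(c + r b, b)` to `(c + r (b + 5 c), b + 5 c)`. -/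
def parabolic (r : R) : SL(2, R) :=
  ⟨!![1 + 5 * r, -5 * r ^ 2; 5, 1 - 5 * r], by rw [Matrix.det_fin_two_of]; ring⟩

lemma parabolic_coe (r : R) :
    (parabolic r).1 = !![1 + 5 * r, -5 * r ^ 2; 5, 1 - 5 * r] := rfl

lemma parabolic_inv (r : R) :
    ((parabolic r)⁻¹ : SL(2, R)).1 = !![1 - 5 * r, 5 * r ^ 2; -5, 1 + 5 * r] := by
  rw [Matrix.SpecialLinearGroup.SL2_inv_expl]
  ext i j
  fin_cases i <;> fin_cases j <;> simp [parabolic]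

lemma parabolic_mul_apply (r : R) (g : SL(2, R)) :
    (parabolic r * g).1 1 0 = g.1 1 0 + 5 * (g.1 0 0 - r * g.1 1 0) ∧
      (parabolic r * g).1 0 0 - r * (parabolic r * g).1 1 0 = g.1 0 0 - r * g.1 1 0 := by
  constructor <;>
  · simp only [Matrix.SpecialLinearGroup.coe_mul, Matrix.mul_apply, Fin.sum_univ_two,
      parabolic_coe, Matrix.of_apply, Matrix.cons_val_zero, Matrix.cons_val_one]
    ring

lemma parabolic_inv_mul_apply (r : R) (g : SL(2, R)) :
    ((parabolic r)⁻¹ * g).1 1 0 = g.1 1 0 - 5 * (g.1 0 0 - r * g.1 1 0) ∧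
      ((parabolic r)⁻¹ * g).1 0 0 - r * ((parabolic r)⁻¹ * g).1 1 0 =
        g.1 0 0 - r * g.1 1 0 := by
  constructor <;>
  · simp only [Matrix.SpecialLinearGroup.coe_mul, Matrix.mul_apply, Fin.sum_univ_two,
      parabolic_inv, Matrix.of_apply, Matrix.cons_val_zero, Matrix.cons_val_one]
    ring

variable [LinearOrder R] [IsStrictOrderedRing R]

/-- The attracting set of `parabolic r`, in terms of the first column. -/
def attractingSet (r : R) : Set SL(2, R) :=
  {g | 5 * (g.1 0 0 - r * g.1 1 0) ^ 2 ≤ 2 * g.1 1 0 * (g.1 0 0 - r * g.1 1 0)}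

/-- The repelling set of `parabolic r`, in terms of the first column. -/
def repellingSet (r : R) : Set SL(2, R) :=
  {g | 2 * g.1 1 0 * (g.1 0 0 - r * g.1 1 0) < -5 * (g.1 0 0 - r * g.1 1 0) ^ 2}

/-- The first column of `g` is close to the direction `(r, 1)`. -/
def nearSet (r : R) : Set SL(2, R) :=
  {g | 5 * |g.1 0 0 - r * g.1 1 0| ≤ 2 * |g.1 1 0|}

lemma five_mul_abs_le_of_sq_le {b c : R} (h : 5 * c ^ 2 ≤ |2 * b * c|) : 5 * |c| ≤ 2 * |b| := by
  rw [abs_mul, abs_mul, abs_two, ← sq_abs] at h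
  rcases (abs_nonneg c).eq_or_lt with hc | hc
  · rw [← hc]
    simp
  · exact le_of_mul_le_mul_right (by linarith) hc

lemma attractingSet_subset_nearSet (r : R) : attractingSet r ⊆ nearSet r :=
  fun _ hg => five_mul_abs_le_of_sq_le (le_trans hg (le_abs_self _))

lemma repellingSet_subset_nearSet (r : R) : repellingSet r ⊆ nearSet r := by
  intro g hg
  have hg' : _ < _ := hg
  exact five_mul_abs_le_of_sq_le (le_trans (by linarith) (neg_le_abs _))

lemma disjoint_nearSet {r s : R} (h : 1 ≤ |r - s|) : Disjoint (nearSet r) (nearSet s) := by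
  rw [Set.disjoint_left]
  intro g hr hs
  have hr' : 5 * |g.1 0 0 - r * g.1 1 0| ≤ 2 * |g.1 1 0| := hr
  have hs' : 5 * |g.1 0 0 - s * g.1 1 0| ≤ 2 * |g.1 1 0| := hs
  have hle : |g.1 1 0| ≤ |r - s| * |g.1 1 0| := le_mul_of_one_le_left (abs_nonneg _) h
  have htri : |r - s| * |g.1 1 0| ≤ |g.1 0 0 - s * g.1 1 0| + |g.1 0 0 - r * g.1 1 0| := by
    rw [← abs_mul]
    calc |(r - s) * g.1 1 0| = |(g.1 0 0 - s * g.1 1 0) - (g.1 0 0 - r * g.1 1 0)| := by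
          congr 1
          ring
      _ ≤ _ := abs_sub _ _
  have hb : g.1 1 0 = 0 := abs_eq_zero.1 (le_antisymm (by linarith) (abs_nonneg _))
  have ha : g.1 0 0 = 0 := by
    rw [hb] at hr'
    simp only [mul_zero, sub_zero, abs_zero] at hr'
    exact abs_eq_zero.1 (le_antisymm (by linarith) (abs_nonneg _))
  have hdet := g.2
  rw [Matrix.det_fin_two, ha, hb] at hdet
  simp at hdet

lemma disjoint_attractingSet_repellingSet (r : R) :
    Disjoint (attractingSet r) (repellingSet r) := by
  rw [Set.disjoint_left]
  intro g hr hs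
  have hr' : _ ≤ _ := hr
  have hs' : _ < _ := hs
  have := sq_nonneg (g.1 0 0 - r * g.1 1 0)
  linarith

omit [IsStrictOrderedRing R] in
lemma attractingSet_nonempty (r : R) : (attractingSet r).Nonempty :=
  ⟨⟨!![r, -1; 1, 0], by simp [Matrix.det_fin_two]⟩, by
    change 5 * (r - r * 1) ^ 2 ≤ 2 * 1 * (r - r * 1)
    simp⟩

open Pointwise in
lemma parabolic_smul_subset (r : R) : parabolic r • (repellingSet r)ᶜ ⊆ attractingSet r := by
  rintro _ ⟨g, hg, rfl⟩
  have hg' : ¬ _ < _ := hg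
  obtain ⟨h₁, h₂⟩ := parabolic_mul_apply r g
  change parabolic r * g ∈ attractingSet r
  change _ ≤ _
  rw [h₂, h₁]
  linarith

open Pointwise in
lemma parabolic_inv_smul_subset (r : R) :
    (parabolic r)⁻¹ • (attractingSet r)ᶜ ⊆ repellingSet r := by
  rintro _ ⟨g, hg, rfl⟩
  have hg' : ¬ _ ≤ _ := hg
  obtain ⟨h₁, h₂⟩ := parabolic_inv_mul_apply r g
  change (parabolic r)⁻¹ * g ∈ repellingSet r
  change _ < _
  rw [h₂, h₁]
  linarith

/-- Parabolic elements at points of mutual distance at least `1` generate a free group. -/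
theorem injective_lift_parabolic {ι : Type u} [Nontrivial ι] (r : ι → R)
    (hr : Pairwise fun i j => 1 ≤ |r i - r j|) :
    Function.Injective (FreeGroup.lift fun i => parabolic (r i)) := by
  refine FreeGroup.injective_lift_of_ping_pong (fun i => parabolic (r i))
    (fun i => attractingSet (r i)) (fun i => repellingSet (r i))
    (fun i => attractingSet_nonempty _) ?_ ?_ ?_ ?_ ?_
  · exact fun i j hij => (disjoint_nearSet (hr hij)).mono (attractingSet_subset_nearSet _)
      (attractingSet_subset_nearSet _)
  · exact fun i j hij => (disjoint_nearSet (hr hij)).mono (repellingSet_subset_nearSet _)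
      (repellingSet_subset_nearSet _)
  · intro i j
    by_cases hij : i = j
    · subst hij
      exact disjoint_attractingSet_repellingSet _
    · exact (disjoint_nearSet (hr hij)).mono (attractingSet_subset_nearSet _)
        (repellingSet_subset_nearSet _)
  · exact fun i => parabolic_smul_subset (r i)
  · exact fun i => parabolic_inv_smul_subset (r i)

end Parabolic

/-! ### A normal form in groups generated by `x` and `t` with `t ^ n` central -/

section NormalForm

variable {G : Type*} [Group G] {n : ℕ} {x t : G}

/-- The conjugate `t ^ j * x * t ^ (-j)`, indexed by `ZMod n`. -/
def conjFamily (n : ℕ) (x t : G) (j : ZMod n) : G := t ^ (j.cast : ℤ) * x * (t ^ (j.cast : ℤ))⁻¹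

lemma conjFamily_intCast (h : Commute (t ^ n) x) (k : ℤ) :
    conjFamily n x t (k : ZMod n) = t ^ k * x * (t ^ k)⁻¹ := by
  obtain ⟨m, hm⟩ : (n : ℤ) ∣ k - ((k : ZMod n).cast : ℤ) := by
    rw [← ZMod.intCast_eq_intCast_iff_dvd_sub, ZMod.intCast_cast, ZMod.cast_id]
  have hc : Commute (t ^ ((n : ℤ) * m)) x := by
    rw [zpow_mul, zpow_natCast]
    exact h.zpow_left m
  rw [conjFamily, show k = ((k : ZMod n).cast : ℤ) + n * m by linarith, zpow_add, mul_inv_rev,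
    mul_assoc _ _ x, hc.eq]
  simp [mul_assoc]

lemma conj_lift_conjFamily (h : Commute (t ^ n) x) (k : ℤ) (w : FreeGroup (ZMod n)) :
    t ^ k * FreeGroup.lift (conjFamily n x t) w * (t ^ k)⁻¹ =
      FreeGroup.lift (conjFamily n x t) (FreeGroup.map (fun j => (k : ZMod n) + j) w) := by
  have key : (MulAut.conj (t ^ k)).toMonoidHom.comp (FreeGroup.lift (conjFamily n x t)) =
      (FreeGroup.lift (conjFamily n x t)).comp (FreeGroup.map (fun j => (k : ZMod n) + j)) := by
    ext j
    obtain ⟨l, rfl⟩ := ZMod.intCast_surjective j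
    simp only [MonoidHom.comp_apply, FreeGroup.lift_apply_of, FreeGroup.map.of]
    rw [← Int.cast_add, conjFamily_intCast h, conjFamily_intCast h, zpow_add]
    simp only [MulEquiv.toMonoidHom_eq_coe, MonoidHom.coe_coe, MulAut.conj_apply]
    group
  exact DFunLike.congr_fun key w

/-- The subgroup of elements of the form `w * t ^ k`, with `w` a word in the conjugates of `x`
by powers of `t`. -/
def normalFormSubgroup (h : Commute (t ^ n) x) : Subgroup G where
  carrier := {g | ∃ (w : FreeGroup (ZMod n)) (k : ℤ),
    g = FreeGroup.lift (conjFamily n x t) w * t ^ k}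
  one_mem' := ⟨1, 0, by simp⟩
  mul_mem' := by
    rintro _ _ ⟨w, k, rfl⟩ ⟨v, l, rfl⟩
    refine ⟨w * FreeGroup.map (fun j => (k : ZMod n) + j) v, k + l, ?_⟩
    rw [map_mul, ← conj_lift_conjFamily h, zpow_add]
    simp [mul_assoc]
  inv_mem' := by
    rintro _ ⟨w, k, rfl⟩
    refine ⟨FreeGroup.map (fun j => ((-k : ℤ) : ZMod n) + j) w⁻¹, -k, ?_⟩
    rw [← conj_lift_conjFamily h]
    simp

lemma left_mem_normalFormSubgroup (h : Commute (t ^ n) x) : x ∈ normalFormSubgroup h := by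
  refine ⟨FreeGroup.of ((0 : ℤ) : ZMod n), 0, ?_⟩
  rw [FreeGroup.lift_apply_of, conjFamily_intCast h]
  simp

lemma right_mem_normalFormSubgroup (h : Commute (t ^ n) x) : t ∈ normalFormSubgroup h :=
  ⟨1, 1, by simp⟩

end NormalForm

/-! ### The induced representation -/

section Representation

variable {R : Type*} [CommRing R] {n : ℕ}

/-- The block diagonal automorphism with blocks `a (-i)`. -/
def blockDiag (a : ZMod n → SL(2, R)) : (ZMod n → Fin 2 → R) ≃ₗ[R] (ZMod n → Fin 2 → R) :=
  LinearEquiv.piCongrRight fun i => Matrix.SpecialLinearGroup.toLin' (a (-i))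

lemma blockDiag_apply (a : ZMod n → SL(2, R)) (f : ZMod n → Fin 2 → R) (i : ZMod n) :
    blockDiag a f i = Matrix.SpecialLinearGroup.toLin' (a (-i)) (f i) := rfl

/-- The cyclic permutation of the blocks, scaled by a unit. -/
def scaledShift (n : ℕ) (u : Rˣ) : (ZMod n → Fin 2 → R) ≃ₗ[R] (ZMod n → Fin 2 → R) :=
  (LinearEquiv.funCongrLeft R (Fin 2 → R) (Equiv.subRight (1 : ZMod n))).trans
    (LinearEquiv.smulOfUnit u)

lemma scaledShift_apply (u : Rˣ) (f : ZMod n → Fin 2 → R) (i : ZMod n) :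
    scaledShift n u f i = u • f (i - 1) := rfl

lemma scaledShift_zpow_apply (u : Rˣ) (k : ℤ) :
    ∀ (f : ZMod n → Fin 2 → R) (i : ZMod n),
      (scaledShift n u ^ k) f i = u ^ k • f (i - k) := by
  induction k with
  | zero => simp
  | succ k ih =>
    intro f i
    rw [zpow_add_one, LinearEquiv.mul_apply, ih, scaledShift_apply, smul_smul, zpow_add_one]
    push_cast
    congr 2
    ring
  | pred k ih =>
    intro f i
    obtain ⟨g, rfl⟩ := (scaledShift n u).surjective f
    rw [zpow_sub_one, LinearEquiv.mul_apply]
    have : (scaledShift n u)⁻¹ (scaledShift n u g) = g := (scaledShift n u).symm_apply_apply g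
    rw [this, ih, scaledShift_apply, smul_smul, zpow_sub_one]
    push_cast
    rw [inv_mul_cancel_right]
    congr 2
    ring

lemma commute_scaledShift_pow (u : Rˣ) (a : ZMod n → SL(2, R)) :
    Commute (scaledShift n u ^ n) (blockDiag a) := by
  have hpow (f : ZMod n → Fin 2 → R) : (scaledShift n u ^ n) f = u ^ n • f := by
    ext i : 1
    rw [← zpow_natCast, scaledShift_zpow_apply]
    simp
  ext1 f
  rw [LinearEquiv.mul_apply, LinearEquiv.mul_apply, hpow, hpow]
  exact (map_smul (blockDiag a) ((u ^ n : Rˣ) : R) f).symm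

lemma lift_conjFamily_blockDiag_apply_zero (u : Rˣ) (a : ZMod n → SL(2, R))
    (w : FreeGroup (ZMod n)) (f : ZMod n → Fin 2 → R) :
    FreeGroup.lift (conjFamily n (blockDiag a) (scaledShift n u)) w f 0 =
      Matrix.SpecialLinearGroup.toLin' (FreeGroup.lift a w) (f 0) := by
  induction w using FreeGroup.induction_on generalizing f with
  | C1 => simp
  | of j =>
    rw [FreeGroup.lift_apply_of, FreeGroup.lift_apply_of, conjFamily, ← zpow_neg,
      LinearEquiv.mul_apply, LinearEquiv.mul_apply, scaledShift_zpow_apply, blockDiag_apply,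
      scaledShift_zpow_apply]
    simp only [Units.smul_def, map_smul, smul_smul]
    simp
  | inv_of j ih =>
    set L := FreeGroup.lift (conjFamily n (blockDiag a) (scaledShift n u)) (FreeGroup.of j)
    obtain ⟨g, rfl⟩ := L.surjective f
    rw [ih, map_inv, map_inv, map_inv]
    rw [show L⁻¹ (L g) = g from L.symm_apply_apply g]
    exact (LinearEquiv.symm_apply_apply _ _).symm
  | mul v w hv hw => simp only [map_mul, LinearEquiv.mul_apply, hv, hw]

/-- A word in the blocks times a power of the scaled shift is trivial only for trivial reasons. -/
lemma eq_one_of_lift_mul_zpow_eq_one {u : Rˣ} (hu : ∀ k : ℤ, u ^ k = 1 → k = 0)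
    {a : ZMod n → SL(2, R)} (ha : Function.Injective (FreeGroup.lift a))
    {w : FreeGroup (ZMod n)} {k : ℤ}
    (h : FreeGroup.lift (conjFamily n (blockDiag a) (scaledShift n u)) w * scaledShift n u ^ k = 1) :
    w = 1 ∧ k = 0 := by
  have happly (v : Fin 2 → R) :
      (u ^ k) • Matrix.SpecialLinearGroup.toLin' (FreeGroup.lift a w) v = v := by
    have h0 := congrFun (DFunLike.congr_fun h fun _ => v) 0
    rw [LinearEquiv.mul_apply, lift_conjFamily_blockDiag_apply_zero, scaledShift_zpow_apply] at h0
    simp only [Units.smul_def, map_smul] at h0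
    exact h0
  have hmat : ((u ^ k : Rˣ) : R) • (FreeGroup.lift a w).1 = 1 := by
    apply Matrix.toLin'.injective
    refine LinearMap.ext fun v => ?_
    rw [map_smul, Matrix.toLin'_one]
    exact happly v
  have hk : k = 0 := by
    have hdet := congrArg Matrix.det hmat
    rw [Matrix.det_smul, (FreeGroup.lift a w).2, Matrix.det_one, Fintype.card_fin, mul_one,
      ← Units.val_pow_eq_pow_val, Units.val_eq_one, ← zpow_natCast, ← zpow_mul] at hdet
    have := hu _ hdet
    omega
  refine ⟨ha ?_, hk⟩
  subst hk
  rw [zpow_zero, Units.val_one, one_smul] at hmat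
  rw [map_one]
  exact Subtype.ext hmat

end Representation

/-! ### The Artin group -/

section Artin

variable {n : ℕ}

/-- The homomorphism out of `A(2n)` sending `x` to `g` and `x * y` to `s`. -/
def ArtinEven.lift {G : Type*} [Group G] {g s : G} (h : Commute (s ^ n) g) : ArtinEven n →* G :=
  PresentedGroup.toGroup (f := ![g, g⁻¹ * s]) (rels := artinEvenRels n) (by
    rintro _ rfl
    have hconj : g⁻¹ * s * g = g⁻¹ * s * (g⁻¹)⁻¹ := by simp
    simp only [map_mul, map_pow, map_inv, FreeGroup.lift_apply_of, Matrix.cons_val_zero,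
      Matrix.cons_val_one, mul_inv_cancel_left]
    rw [hconj, conj_pow, inv_inv, mul_assoc, h.eq, inv_mul_cancel_left, mul_inv_cancel])

lemma ArtinEven.commute_pow : Commute
    ((PresentedGroup.of 0 * PresentedGroup.of 1 : ArtinEven n) ^ n) (PresentedGroup.of 0) := by
  have hrel : (PresentedGroup.of 0 * PresentedGroup.of 1 : ArtinEven n) ^ n =
      (PresentedGroup.of 1 * PresentedGroup.of 0) ^ n := by
    rw [← mul_inv_eq_one]
    exact PresentedGroup.one_of_mem (rels := artinEvenRels n) rfl
  have hconj : (PresentedGroup.of 1 * PresentedGroup.of 0 : ArtinEven n) =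
      (PresentedGroup.of 0)⁻¹ * (PresentedGroup.of 0 * PresentedGroup.of 1) *
        ((PresentedGroup.of 0)⁻¹)⁻¹ := by
    simp
  rw [hconj, conj_pow, inv_inv, mul_assoc, eq_inv_mul_iff_mul_eq] at hrel
  exact hrel.symm

lemma ArtinEven.exists_normalForm (g : ArtinEven n) : ∃ (w : FreeGroup (ZMod n)) (k : ℤ),
    g = FreeGroup.lift (conjFamily n (PresentedGroup.of 0)
      (PresentedGroup.of 0 * PresentedGroup.of 1)) w *
        (PresentedGroup.of 0 * PresentedGroup.of 1) ^ k := by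
  have hx := left_mem_normalFormSubgroup (ArtinEven.commute_pow (n := n))
  have ht := right_mem_normalFormSubgroup (ArtinEven.commute_pow (n := n))
  refine PresentedGroup.generated_by _ (normalFormSubgroup (ArtinEven.commute_pow (n := n))) ?_ g
  rw [Fin.forall_fin_two]
  exact ⟨hx, (Subgroup.mul_mem_cancel_left _ hx).1 ht⟩

lemma ArtinEven.lift_injective {G : Type*} [Group G] {g s : G} (h : Commute (s ^ n) g)
    (hfree : ∀ (w : FreeGroup (ZMod n)) (k : ℤ),
      FreeGroup.lift (conjFamily n g s) w * s ^ k = 1 → w = 1 ∧ k = 0) :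
    Function.Injective (ArtinEven.lift h) := by
  rw [injective_iff_map_eq_one]
  intro z hz
  obtain ⟨w, k, rfl⟩ := ArtinEven.exists_normalForm z
  have h0 : ArtinEven.lift h (PresentedGroup.of 0) = g := PresentedGroup.toGroup.of _
  have h1 : ArtinEven.lift h (PresentedGroup.of 1) = g⁻¹ * s := PresentedGroup.toGroup.of _
  have hcomp : (ArtinEven.lift h).comp (FreeGroup.lift (conjFamily n (PresentedGroup.of 0)
      (PresentedGroup.of 0 * PresentedGroup.of 1))) = FreeGroup.lift (conjFamily n g s) := by
    ext j
    simp [conjFamily, h0, h1]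
  obtain ⟨rfl, rfl⟩ := hfree w k (by
    rw [map_mul, ← MonoidHom.comp_apply, hcomp, map_zpow, map_mul, h0, h1,
      mul_inv_cancel_left] at hz
    exact hz)
  simp

/-- The prime `p` as a unit of `ℤ[1/p]`. -/
def ZinvP.unit {p : ℕ} (hp : p.Prime) : (ZinvP p)ˣ where
  val := p
  inv := ⟨(p : ℚ)⁻¹, Subring.subset_closure rfl⟩
  val_inv := Subtype.ext (mul_inv_cancel₀ (by exact_mod_cast hp.ne_zero))
  inv_val := Subtype.ext (inv_mul_cancel₀ (by exact_mod_cast hp.ne_zero))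

lemma ZinvP.unit_zpow_eq_one {p : ℕ} (hp : p.Prime) (k : ℤ) (h : ZinvP.unit hp ^ k = 1) :
    k = 0 := by
  have hq := congrArg (fun v : (ZinvP p)ˣ => (Units.map (ZinvP p).subtype.toMonoidHom v : ℚ)) h
  simp only [map_zpow, map_one, Units.val_one, Units.val_zpow_eq_zpow_val] at hq
  have hval : ((Units.map (ZinvP p).subtype.toMonoidHom (ZinvP.unit hp) : ℚˣ) : ℚ) = p := rfl
  rw [hval] at hq
  have h1 : (1 : ℚ) < p := by exact_mod_cast hp.one_lt
  exact (zpow_eq_one_iff_right₀ (by positivity) h1.ne').1 hq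

end Artin

/-- For `n ≥ 2` and a prime `p`, the Artin group `A(2n)` has a faithful linear
representation by `2n × 2n` matrices over the ring `ℤ[1/p]`. -/
theorem artin_even_linear_over_Zp (n : ℕ) (hn : 2 ≤ n) (p : ℕ) (hp : p.Prime) :
    ∃ ρ : ArtinEven n →* GL (Fin (2 * n)) (ZinvP p), Function.Injective ρ := by
  have : NeZero n := ⟨by omega⟩
  have : Fact (1 < n) := ⟨by omega⟩
  let a : ZMod n → SL(2, ZinvP p) := fun i => parabolic (((i.cast : ℤ) : ZinvP p))
  have ha : Function.Injective (FreeGroup.lift a) := by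
    refine injective_lift_parabolic _ fun i j hij => ?_
    have hne : (i.cast : ℤ) - j.cast ≠ 0 :=
      sub_ne_zero.2 fun h => hij <| by
        rw [← ZMod.intCast_zmod_cast i, h, ZMod.intCast_zmod_cast]
    beta_reduce
    rw [← Int.cast_sub, ← Int.cast_abs]
    exact_mod_cast Int.one_le_abs hne
  have hfin : Module.finrank (ZinvP p) (ZMod n → Fin 2 → ZinvP p) = 2 * n := by
    simp [Module.finrank_pi_fintype, ZMod.card, mul_comm]
  let b := Module.finBasisOfFinrankEq (ZinvP p) (ZMod n → Fin 2 → ZinvP p) hfin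
  let e : ((ZMod n → Fin 2 → ZinvP p) ≃ₗ[ZinvP p] (ZMod n → Fin 2 → ZinvP p)) ≃*
      GL (Fin (2 * n)) (ZinvP p) :=
    (LinearMap.GeneralLinearGroup.generalLinearEquiv _ _).symm.trans
      (Units.mapEquiv (LinearMap.toMatrixAlgEquiv b).toMulEquiv)
  refine ⟨e.toMonoidHom.comp
    (ArtinEven.lift (commute_scaledShift_pow (ZinvP.unit hp) a)), ?_⟩
  exact e.injective.comp (ArtinEven.lift_injective _ fun w k =>
    eq_one_of_lift_mul_zpow_eq_one (ZinvP.unit_zpow_eq_one hp) ha)
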